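/- arXiv:2407.17396 — 5 statements merged into one kernel-verified Lean document; each statement's English description precedes it below -/
import Mathlib

section
/- Let 𝓚 be a finite set of simple path rules and 𝓕 a finite set of facts. Then 𝓚 ∪ 𝓕 ⊨ r(a,b) holds if and only if there exists a relational path r₁;…;r_k connecting a and b in the graph G_𝓕 such that r can be derived from r₁;…;r_k. -/
/-! Setting: finite relation symbols `R`, finite entities `E`.
A fact is a triple `(r, a, b) : R × E × E` meaning `r(a,b)`.
A simple path rule is a triple `(r, r₁, r₂) : R × R × R` meaning
`r(X,Z) ← r₁(X,Y) ∧ r₂(Y,Z)`. -/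

namespace SimplePath

variable {R E : Type*}

/-- One application of the immediate consequence operator. -/
def step (𝓚 : Set (R × R × R)) (S : Set (R × E × E)) : Set (R × E × E) :=
  S ∪ {x | ∃ r r₁ r₂ : R, ∃ a b c : E,
    x = (r, a, c) ∧ (r, r₁, r₂) ∈ 𝓚 ∧ (r₁, a, b) ∈ S ∧ (r₂, b, c) ∈ S}

/-- The sequence `𝓕₀ = 𝓕`, `𝓕ᵢ = 𝓕ᵢ₋₁ ∪ {r(a,c) : …}` of the immediate
consequence operator. -/
def FIter (𝓚 : Set (R × R × R)) (𝓕 : Set (R × E × E)) : ℕ → Set (R × E × E)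
  | 0 => 𝓕
  | i + 1 => step 𝓚 (FIter 𝓚 𝓕 i)

/-- `𝓚 ∪ 𝓕 ⊨ r(a,b)`: the atom belongs to the fixpoint `𝓕*` of the (nondecreasing,
eventually constant) sequence `𝓕ᵢ`, i.e. to some `𝓕ᵢ`. -/
def Entails (𝓚 : Set (R × R × R)) (𝓕 : Set (R × E × E)) (r : R) (a b : E) : Prop :=
  ∃ i : ℕ, (r, a, b) ∈ FIter 𝓚 𝓕 i

/-- `IsRelPath 𝓕 a b [r₁, …, r_k]`: there is a relational path `r₁;…;r_k`
connecting `a` and `b` in the graph `G_𝓕`, i.e. facts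
`r₁(a,x₁), r₂(x₁,x₂), …, r_k(x_{k-1},b)` all belonging to `𝓕`. -/
inductive IsRelPath (𝓕 : Set (R × E × E)) : E → E → List R → Prop
  | single {r : R} {a b : E} : (r, a, b) ∈ 𝓕 → IsRelPath 𝓕 a b [r]
  | cons {r : R} {a x b : E} {rs : List R} :
      (r, a, x) ∈ 𝓕 → IsRelPath 𝓕 x b rs → IsRelPath 𝓕 a b (r :: rs)

/-- One-step derivation on sequences of relations: two adjacent relations
`r₁; r₂` are replaced by `s` when `𝓚` contains the rule `s(X,Z) ← r₁(X,Y) ∧ r₂(Y,Z)`. -/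
inductive DeriveStep (𝓚 : Set (R × R × R)) : List R → List R → Prop
  | step {s r₁ r₂ : R} {p q : List R} :
      (s, r₁, r₂) ∈ 𝓚 → DeriveStep 𝓚 (p ++ r₁ :: r₂ :: q) (p ++ s :: q)

/-- `r` can be derived from the sequence `rs` by a sequence of one-step derivations. -/
def Derives (𝓚 : Set (R × R × R)) (rs : List R) (r : R) : Prop :=
  Relation.ReflTransGen (DeriveStep 𝓚) rs [r]

end SimplePath

namespace SimplePath

variable {R E : Type*} {𝓚 : Set (R × R × R)} {𝓕 𝓖 : Set (R × E × E)}

theorem FIter_monotone (𝓚 : Set (R × R × R)) (𝓕 : Set (R × E × E)) : Monotone (FIter 𝓚 𝓕) :=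
  monotone_nat_of_le_succ fun _ => Set.subset_union_left

theorem Entails.of_mem {r : R} {a b : E} (h : (r, a, b) ∈ 𝓕) : Entails 𝓚 𝓕 r a b :=
  ⟨0, h⟩

theorem Entails.of_rule {r r₁ r₂ : R} {a b c : E} (hr : (r, r₁, r₂) ∈ 𝓚)
    (h₁ : Entails 𝓚 𝓕 r₁ a b) (h₂ : Entails 𝓚 𝓕 r₂ b c) : Entails 𝓚 𝓕 r a c := by
  obtain ⟨i, hi⟩ := h₁
  obtain ⟨j, hj⟩ := h₂
  exact ⟨max i j + 1, Or.inr ⟨r, r₁, r₂, a, b, c, rfl, hr,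
    FIter_monotone 𝓚 𝓕 (le_max_left i j) hi, FIter_monotone 𝓚 𝓕 (le_max_right i j) hj⟩⟩

theorem IsRelPath.mono (h : 𝓕 ⊆ 𝓖) {a b : E} {rs : List R} (hp : IsRelPath 𝓕 a b rs) :
    IsRelPath 𝓖 a b rs := by
  induction hp with
  | single hf => exact .single (h hf)
  | cons hf _ ih => exact .cons (h hf) ih

theorem IsRelPath.append {a b c : E} {rs ss : List R} (h₁ : IsRelPath 𝓕 a b rs)
    (h₂ : IsRelPath 𝓕 b c ss) : IsRelPath 𝓕 a c (rs ++ ss) := by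
  induction h₁ with
  | single hf => exact .cons hf h₂
  | cons hf _ ih => exact .cons hf (ih h₂)

theorem not_isRelPath_nil {a b : E} : ¬ IsRelPath 𝓕 a b ([] : List R) := nofun

theorem isRelPath_singleton {a b : E} {r : R} : IsRelPath 𝓕 a b [r] ↔ (r, a, b) ∈ 𝓕 := by
  refine ⟨fun h => ?_, .single⟩
  cases h with
  | single hf => exact hf
  | cons _ h => exact (not_isRelPath_nil h).elim

theorem DeriveStep.append_left {l l' : List R} (h : DeriveStep 𝓚 l l') (m : List R) :
    DeriveStep 𝓚 (m ++ l) (m ++ l') := by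
  obtain @⟨_, _, _, p, q, hr⟩ := h
  simpa only [List.append_assoc] using DeriveStep.step (p := m ++ p) (q := q) hr

theorem DeriveStep.append_right {l l' : List R} (h : DeriveStep 𝓚 l l') (m : List R) :
    DeriveStep 𝓚 (l ++ m) (l' ++ m) := by
  obtain @⟨_, _, _, p, q, hr⟩ := h
  simpa only [List.append_assoc, List.cons_append] using
    DeriveStep.step (p := p) (q := q ++ m) hr

theorem Derives.of_rule {r r₁ r₂ : R} {rs ss : List R} (hr : (r, r₁, r₂) ∈ 𝓚)
    (h₁ : Derives 𝓚 rs r₁) (h₂ : Derives 𝓚 ss r₂) : Derives 𝓚 (rs ++ ss) r :=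
  ((h₁.lift (· ++ ss) fun _ _ h => h.append_right ss).trans
    (h₂.lift ([r₁] ++ ·) fun _ _ h => h.append_left [r₁])).tail
    (DeriveStep.step (p := []) (q := []) hr)

/-- A set of facts closed under the rules keeps its relational paths under derivation steps. -/
theorem IsRelPath.deriveStep
    (hclosed : ∀ {r r₁ r₂ : R} {a b c : E}, (r, r₁, r₂) ∈ 𝓚 → (r₁, a, b) ∈ 𝓕 →
      (r₂, b, c) ∈ 𝓕 → (r, a, c) ∈ 𝓕)
    {a b : E} {rs ss : List R} (hp : IsRelPath 𝓕 a b rs) (h : DeriveStep 𝓚 rs ss) :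
    IsRelPath 𝓕 a b ss := by
  obtain @⟨s, r₁, r₂, p, q, hr⟩ := h
  induction p generalizing a with
  | nil =>
    cases hp with
    | cons h₁ hp =>
      cases hp with
      | single h₂ => exact .single (hclosed hr h₁ h₂)
      | cons h₂ hp => exact .cons (hclosed hr h₁ h₂) hp
  | cons t p ih =>
    generalize hl : t :: p ++ r₁ :: r₂ :: q = l at hp
    cases hp with
    | single _ => simp at hl
    | cons hf hp =>
      obtain ⟨rfl, rfl⟩ := List.cons.inj hl
      exact .cons hf (ih hp)

theorem Entails.exists_relPath_derives {r : R} {a b : E} (h : Entails 𝓚 𝓕 r a b) :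
    ∃ rs : List R, IsRelPath 𝓕 a b rs ∧ Derives 𝓚 rs r := by
  obtain ⟨i, hi⟩ := h
  induction i generalizing r a b with
  | zero => exact ⟨[r], .single hi, .refl⟩
  | succ i ih =>
    obtain hi | ⟨_, r₁, r₂, _, c, _, heq, hr, h₁, h₂⟩ := hi
    · exact ih hi
    · cases heq
      obtain ⟨rs, hrs, hd₁⟩ := ih h₁
      obtain ⟨ss, hss, hd₂⟩ := ih h₂
      exact ⟨rs ++ ss, hrs.append hss, hd₁.of_rule hr hd₂⟩

theorem IsRelPath.entails {r : R} {a b : E} {rs : List R} (hp : IsRelPath 𝓕 a b rs)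
    (hd : Derives 𝓚 rs r) : Entails 𝓚 𝓕 r a b := by
  let 𝓖 : Set (R × E × E) := {x | Entails 𝓚 𝓕 x.1 x.2.1 x.2.2}
  have hpath {ss : List R} (hd : Relation.ReflTransGen (DeriveStep 𝓚) rs ss) :
      IsRelPath 𝓖 a b ss := by
    induction hd with
    | refl => exact hp.mono fun _ => Entails.of_mem
    | tail _ hstep ih => exact ih.deriveStep Entails.of_rule hstep
  exact isRelPath_singleton.mp (hpath hd)

end SimplePath

open SimplePath in
/-- Proposition 1: `𝓚 ∪ 𝓕 ⊨ r(a,b)` iff there is a relational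
path `r₁;…;r_k` connecting `a` and `b` in `G_𝓕` from which `r` can be derived. -/
theorem entails_iff_exists_relPath_derives
    {R E : Type*} [Fintype R] [Fintype E]
    (𝓚 : Set (R × R × R)) (𝓕 : Set (R × E × E)) (r : R) (a b : E) :
    Entails 𝓚 𝓕 r a b ↔
      ∃ rs : List R, IsRelPath 𝓕 a b rs ∧ Derives 𝓚 rs r := by
  exact ⟨Entails.exists_relPath_derives, fun ⟨_, hp, hd⟩ => hp.entails hd⟩
end

section
/- Assume 𝓚 consists of (i) disjunctive composition rules of the form s₁(X,Z) ∨ … ∨ s_k(X,Z) ← r₁(X,Y) ∧ r₂(Y,Z), (ii) for each pair of distinct relations r₁,r₂ ∈ 𝓡 the disjointness constraint ⊥ ← r₁(X,Y) ∧ r₂(X,Y), and (iii) the exhaustiveness rule ⋁_{r∈𝓡} r(X,Y) ← ⊤. Let h ∈ 𝓔 be the designated head entity and let X_e denote the value of the directional algebraic closure sets X_e^{(i)} upon convergence. Then for every entity e ∈ 𝓔 it holds that 𝓚 ∪ 𝓕 ⊨ ⋁_{r ∈ X_e} r(h,e). -/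
/-! Setting: finite relation symbols `R`, finite entities `E`.
A fact is a triple `(r, a, b) : R × E × E` meaning the ground atom `r(a,b)`.
The knowledge base `𝓚` is represented by its composition map
`comp : R → R → Set R`, where `comp r s` is the set of relations appearing in the
head of the disjunctive composition rule of `𝓚` with body `(r, s)`
(and `comp r s = 𝓡` when `𝓚` contains no such rule), together with the
disjointness constraints for all pairs of distinct relations and the
exhaustiveness rule. -/

namespace Disjunctive

variable {R E : Type*}

/-- `ω` is a Herbrand model of the grounding `𝓚_𝓕` containing `𝓕`: it contains the
facts, satisfies all ground composition rules (if `r(a,b), s(b,c) ∈ ω` then some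
relation from `comp r s` holds between `a` and `c`), all disjointness constraints
(distinct relations never both hold between the same pair), and the exhaustiveness
rule (some relation holds between any pair). -/
def IsModel (comp : R → R → Set R) (𝓕 : Set (R × E × E)) (ω : Set (R × E × E)) : Prop :=
  𝓕 ⊆ ω ∧
  (∀ r s : R, ∀ a b c : E, (r, a, b) ∈ ω → (s, b, c) ∈ ω →
    ∃ t ∈ comp r s, (t, a, c) ∈ ω) ∧
  (∀ r s : R, ∀ a b : E, r ≠ s → ¬((r, a, b) ∈ ω ∧ (s, a, b) ∈ ω)) ∧
  (∀ a b : E, ∃ r : R, (r, a, b) ∈ ω)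

/-- `X ◇ s = ⋃ {r∘s : r ∈ X}`. -/
def diamond (comp : R → R → Set R) (X : Set R) (s : R) : Set R :=
  ⋃ r ∈ X, comp r s

/-- The directional algebraic closure sets `X_e^{(i)}` for head entity `hd`:
`X_e^{(0)} = {r}` if `r(hd,e) ∈ 𝓕` and `X_e^{(0)} = 𝓡` otherwise; for `i ≥ 1`,
`X_e^{(i)} = X_e^{(i−1)} ∩ ⋂ {X_f^{(i−1)} ◇ s : s(f,e) ∈ 𝓕}`. -/
def dac (comp : R → R → Set R) (𝓕 : Set (R × E × E)) (hd : E) : ℕ → E → Set R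
  | 0 => fun e => {r | (r, hd, e) ∈ 𝓕 ∨ ∀ s : R, (s, hd, e) ∉ 𝓕}
  | i + 1 => fun e =>
      dac comp 𝓕 hd i e ∩
        ⋂ (f : E) (s : R) (_ : (s, f, e) ∈ 𝓕), diamond comp (dac comp 𝓕 hd i f) s

/-- `X ◇ Y = ⋃ {r∘s : r ∈ X, s ∈ Y}`. -/
def diamond2 (comp : R → R → Set R) (X Y : Set R) : Set R :=
  ⋃ r ∈ X, ⋃ s ∈ Y, comp r s

/-- The full algebraic closure sets `X_{ef}^{(i)}` (with designated inverses `inv`):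
`X_{ef}^{(0)} = {r}` if `r(e,f) ∈ 𝓕`, `X_{ef}^{(0)} = {r̂}` if `r(f,e) ∈ 𝓕`, and
`X_{ef}^{(0)} = 𝓡` otherwise; for `i ≥ 1`,
`X_{ef}^{(i)} = X_{ef}^{(i−1)} ∩ ⋂ {X_{eg}^{(i−1)} ◇ X_{gf}^{(i−1)} : g ∈ 𝓔}`. -/
def fac (comp : R → R → Set R) (inv : R → R) (𝓕 : Set (R × E × E)) :
    ℕ → E → E → Set R
  | 0 => fun e f => {t | (t, e, f) ∈ 𝓕 ∨ (∃ s : R, (s, f, e) ∈ 𝓕 ∧ t = inv s) ∨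
      ((∀ s : R, (s, e, f) ∉ 𝓕) ∧ ∀ s : R, (s, f, e) ∉ 𝓕)}
  | i + 1 => fun e f =>
      fac comp inv 𝓕 i e f ∩
        ⋂ g : E, diamond2 comp (fac comp inv 𝓕 i e g) (fac comp inv 𝓕 i g f)

end Disjunctive

namespace Disjunctive

/-- In a model, composition and disjointness together force the relation between two entities
to lie in the composition set. -/
theorem IsModel.mem_comp {R E : Type*} {comp : R → R → Set R} {𝓕 ω : Set (R × E × E)}
    (hω : IsModel comp 𝓕 ω) {r s t : R} {a b c : E} (hr : (r, a, b) ∈ ω)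
    (hs : (s, b, c) ∈ ω) (ht : (t, a, c) ∈ ω) : t ∈ comp r s := by
  obtain ⟨u, hu, huω⟩ := hω.2.1 r s a b c hr hs
  by_contra h
  exact hω.2.2.1 u t a c (fun hut => h (hut ▸ hu)) ⟨huω, ht⟩

/-- Every stage of directional algebraic closure contains all relations that a model
assigns between the head entity and the given entity. -/
theorem IsModel.mem_dac {R E : Type*} {comp : R → R → Set R} {𝓕 ω : Set (R × E × E)}
    (hω : IsModel comp 𝓕 ω) (hd : E) (i : ℕ) {e : E} {r : R} (hr : (r, hd, e) ∈ ω) :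
    r ∈ dac comp 𝓕 hd i e := by
  induction i generalizing e r with
  | zero =>
    by_contra h
    obtain ⟨hr𝓕, s, hs⟩ : (r, hd, e) ∉ 𝓕 ∧ ∃ s : R, (s, hd, e) ∈ 𝓕 := by
      simpa [dac] using h
    exact hω.2.2.1 r s hd e (fun hrs => hr𝓕 (hrs ▸ hs)) ⟨hr, hω.1 hs⟩
  | succ i ih =>
    refine ⟨ih hr, Set.mem_iInter.2 fun f => Set.mem_iInter₂.2 fun s hs => ?_⟩
    obtain ⟨q, hq⟩ := hω.2.2.2 hd f
    exact Set.mem_iUnion₂.2 ⟨q, ih hq, hω.mem_comp hq (hω.1 hs) hr⟩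

end Disjunctive

open Disjunctive in
/-- Proposition 3: with `𝓚` consisting of composition rules,
disjointness constraints and the exhaustiveness rule, if `N` is an index after which
the directional algebraic closure sets have converged (so `dac … N` is the limit value
`X_e`), then for every entity `e` it holds that `𝓚 ∪ 𝓕 ⊨ ⋁_{r ∈ X_e} r(h,e)`:
every Herbrand model of `𝓚_𝓕` containing `𝓕` contains `r(h,e)` for some `r ∈ X_e`. -/
theorem entails_disjunction_of_dac_limit
    {R E : Type*} [Fintype R] [Fintype E]
    (comp : R → R → Set R) (𝓕 : Set (R × E × E)) (hd : E)
    (N : ℕ) (hconv : ∀ m : ℕ, N ≤ m → dac comp 𝓕 hd m = dac comp 𝓕 hd N) :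
    ∀ e : E, ∀ ω : Set (R × E × E), IsModel comp 𝓕 ω →
      ∃ r ∈ dac comp 𝓕 hd N e, (r, hd, e) ∈ ω := by
  intro e ω hω
  obtain ⟨r, hr⟩ := hω.2.2.2 hd e
  exact ⟨r, hω.mem_dac hd N hr, hr⟩
end

section
/- Assume 𝓚 consists of (i) disjunctive composition rules of the form s₁(X,Z) ∨ … ∨ s_k(X,Z) ← r₁(X,Y) ∧ r₂(Y,Z), (ii) for each pair of distinct relations r₁,r₂ ∈ 𝓡 the disjointness constraint ⊥ ← r₁(X,Y) ∧ r₂(X,Y), and (iii) the exhaustiveness rule ⋁_{r∈𝓡} r(X,Y) ← ⊤. Let h ∈ 𝓔 be the designated head entity. Then for every i ≥ 0 and every entity e ∈ 𝓔 it holds that 𝓚 ∪ 𝓕 ⊨ ⋁_{r ∈ X_e^{(i)}} r(h,e). -/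
open Disjunctive in
/-- In a model, any relation that holds between the head entity and `e` belongs to every
directional algebraic closure set of `e`. -/
theorem mem_dac_of_isModel {R E : Type*} {comp : R → R → Set R} {𝓕 ω : Set (R × E × E)}
    (hω : IsModel comp 𝓕 ω) (hd : E) (i : ℕ) {e : E} {r : R} (hr : (r, hd, e) ∈ ω) :
    r ∈ dac comp 𝓕 hd i e := by
  obtain ⟨hsub, hcomp, hdisj, hex⟩ := hω
  have huniq {r s : R} {a b : E} (h₁ : (r, a, b) ∈ ω) (h₂ : (s, a, b) ∈ ω) : r = s :=
    not_not.mp fun hne => hdisj r s a b hne ⟨h₁, h₂⟩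
  induction i generalizing e r with
  | zero =>
    by_cases h : ∃ s, (s, hd, e) ∈ 𝓕
    · obtain ⟨s, hs⟩ := h
      obtain rfl := huniq hr (hsub hs)
      exact Or.inl hs
    · exact Or.inr (not_exists.mp h)
  | succ i ih =>
    refine ⟨ih hr, Set.mem_iInter.mpr fun f => Set.mem_iInter₂.mpr fun s hs => ?_⟩
    obtain ⟨q, hq⟩ := hex hd f
    obtain ⟨t, ht, htω⟩ := hcomp q s hd f e hq (hsub hs)
    obtain rfl := huniq hr htω
    exact Set.mem_biUnion (ih hq) ht

open Disjunctive in
/-- with `𝓚` consisting of composition rules, disjointness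
constraints and the exhaustiveness rule, for every `i ≥ 0` and every entity `e`,
`𝓚 ∪ 𝓕 ⊨ ⋁_{r ∈ X_e^{(i)}} r(h,e)`: every Herbrand model of `𝓚_𝓕` containing `𝓕`
contains `r(h,e)` for some `r ∈ X_e^{(i)}`. -/
theorem entails_disjunction_of_dac
    {R E : Type*} [Fintype R] [Fintype E]
    (comp : R → R → Set R) (𝓕 : Set (R × E × E)) (hd : E) :
    ∀ (i : ℕ) (e : E), ∀ ω : Set (R × E × E), IsModel comp 𝓕 ω →
      ∃ r ∈ dac comp 𝓕 hd i e, (r, hd, e) ∈ ω := by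
  intro i e ω hω
  obtain ⟨r, hr⟩ := hω.2.2.2 hd e
  exact ⟨r, mem_dac_of_isModel hω hd i hr, hr⟩
end

section
/- Assume 𝓚 consists of (i) disjunctive composition rules, (ii) for each pair of distinct relations the corresponding disjointness constraint, and (iii) the exhaustiveness rule. Fix i ≥ 1 and suppose that for every entity f ∈ 𝓔 it holds that 𝓚 ∪ 𝓕 ⊨ ⋁_{t ∈ X_f^{(i−1)}} t(h,f). Then for every entity e ∈ 𝓔 and every relation r ∈ X_e^{(i−1)} \ X_e^{(i)}, every Herbrand model of 𝓚_𝓕 that contains 𝓕 does not contain the atom r(h,e) (i.e., 𝓚 ∪ 𝓕 ⊨ ¬r(h,e)). -/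
open Disjunctive in
/-- fix `i ≥ 1` (here written `i + 1`) and suppose that for every
entity `f`, `𝓚 ∪ 𝓕 ⊨ ⋁_{t ∈ X_f^{(i−1)}} t(h,f)`. Then for every entity `e` and
relation `r ∈ X_e^{(i−1)} \ X_e^{(i)}`, every Herbrand model of `𝓚_𝓕` containing `𝓕`
does not contain the atom `r(h,e)`, i.e. `𝓚 ∪ 𝓕 ⊨ ¬r(h,e)`. -/
theorem not_mem_model_of_removed_from_dac
    {R E : Type*} [Fintype R] [Fintype E]
    (comp : R → R → Set R) (𝓕 : Set (R × E × E)) (hd : E) (i : ℕ)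
    (hIH : ∀ f : E, ∀ ω : Set (R × E × E), IsModel comp 𝓕 ω →
      ∃ t ∈ dac comp 𝓕 hd i f, (t, hd, f) ∈ ω) :
    ∀ e : E, ∀ r : R,
      r ∈ dac comp 𝓕 hd i e → r ∉ dac comp 𝓕 hd (i + 1) e →
      ∀ ω : Set (R × E × E), IsModel comp 𝓕 ω → (r, hd, e) ∉ ω := by
  intro e r hr hr' ω hω hrω
  refine hr' ⟨hr, ?_⟩
  simp only [Set.mem_iInter, diamond, Set.mem_iUnion]
  intro f s hs
  obtain ⟨t, ht, htω⟩ := hIH f ω hω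
  obtain ⟨hF, hcomp, hdisj, -⟩ := hω
  obtain ⟨u, hu, huω⟩ := hcomp t s hd f e htω (hF hs)
  obtain rfl : r = u := by_contra fun hne => hdisj r u hd e hne ⟨hrω, huω⟩
  exact ⟨t, ht, hu⟩
end

section
/- Assume 𝓚 consists of (i) disjunctive composition rules, (ii) for each pair of distinct relations the corresponding disjointness constraint, and (iii) the exhaustiveness rule, and assume 𝓚 ∪ 𝓕 is consistent. If 𝓕 contains facts r_l(h,e) and r_p(f,e) for entities h, e, f with f ≠ h, then there exists a relation r_q ∈ 𝓡 such that r_l ∈ r_q ∘ r_p. -/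
/-! Setting: finite relation symbols `R`, finite entities `E`.
A fact is a triple `(r, a, b) : R × E × E` meaning the ground atom `r(a,b)`.
The knowledge base `𝓚` is represented by its composition map `comp : R → R → Set R`
(`comp r s = r∘s`, the head of the composition rule with body `(r,s)`, with
`comp r s = 𝓡` when no such rule exists), together with the disjointness
constraints for all pairs of distinct relations and the exhaustiveness rule.

Embedding coordinates are indexed by `Option R ≃ 𝓡 ∪ {id}`: the first coordinate
(the identity relation `id`, i.e. `r₁`) is `none`, and coordinates `2 ≤ j ≤ n`
are `some r` for `r ∈ 𝓡`. -/

open Classical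

namespace EpiGNN

variable {R E : Type*}

/-- `ω` is a Herbrand model of the grounding `𝓚_𝓕` containing `𝓕`. -/
def IsModel (comp : R → R → Set R) (𝓕 : Set (R × E × E)) (ω : Set (R × E × E)) : Prop :=
  𝓕 ⊆ ω ∧
  (∀ r s : R, ∀ a b c : E, (r, a, b) ∈ ω → (s, b, c) ∈ ω →
    ∃ t ∈ comp r s, (t, a, c) ∈ ω) ∧
  (∀ r s : R, ∀ a b : E, r ≠ s → ¬((r, a, b) ∈ ω ∧ (s, a, b) ∈ ω)) ∧
  (∀ a b : E, ∃ r : R, (r, a, b) ∈ ω)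

/-- `X ◇ s = ⋃ {r∘s : r ∈ X}`. -/
def diamond (comp : R → R → Set R) (X : Set R) (s : R) : Set R :=
  ⋃ r ∈ X, comp r s

/-- Directional algebraic closure sets `X_e^{(i)}` for head entity `hd`. -/
def dac (comp : R → R → Set R) (𝓕 : Set (R × E × E)) (hd : E) : ℕ → E → Set R
  | 0 => fun e => {r | (r, hd, e) ∈ 𝓕 ∨ ∀ s : R, (s, hd, e) ∉ 𝓕}
  | i + 1 => fun e =>
      dac comp 𝓕 hd i e ∩
        ⋂ (f : E) (s : R) (_ : (s, f, e) ∈ 𝓕), diamond comp (dac comp 𝓕 hd i f) s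

noncomputable section

/-- `one-hot(j)`: the vector which is `1` in coordinate `j` and `0` elsewhere. -/
def oneHot (j : Option R) : Option R → ℝ := fun l => if l = j then 1 else 0

/-- A probability vector: non-negative coordinates summing to `1`. -/
def IsProbVec [Fintype R] (v : Option R → ℝ) : Prop :=
  (∀ j, 0 ≤ v j) ∧ ∑ j : Option R, v j = 1

/-- The bilinear composition `φ(f, ρ) = Σᵢ Σⱼ fᵢ ρⱼ 𝐚_{ij}`. -/
def phi [Fintype R] (a : Option R → Option R → Option R → ℝ)
    (f ρ : Option R → ℝ) : Option R → ℝ :=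
  fun l => ∑ i : Option R, ∑ j : Option R, f i * ρ j * a i j l

/-- Initial embeddings: `𝐞^{(0)} = (1,0,…,0)` if `e = hd`, else `(1/n,…,1/n)`. -/
def initEmb [Fintype R] (hd e : E) : Option R → ℝ :=
  if e = hd then oneHot none else fun _ => ((Fintype.card (Option R) : ℝ))⁻¹

/-- Unnormalized min-pooled message: the componentwise minimum of
`{prev e} ∪ {φ(prev f, 𝐫_p) : r_p(f,e) ∈ 𝓕}`. -/
def rawMin [Fintype R] (rvec : Option R → Option R → ℝ)
    (a : Option R → Option R → Option R → ℝ) (𝓕 : Set (R × E × E))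
    (prev : E → Option R → ℝ) (e : E) (j : Option R) : ℝ :=
  sInf (insert (prev e j)
    {x : ℝ | ∃ (p : R) (f : E), (p, f, e) ∈ 𝓕 ∧ x = phi a (prev f) (rvec (some p)) j})

/-- The forward EpiGNN with min-pooling `ψ_min` (componentwise minimum followed by
`L¹` normalization). -/
def embMin [Fintype R] (rvec : Option R → Option R → ℝ)
    (a : Option R → Option R → Option R → ℝ) (𝓕 : Set (R × E × E)) (hd : E) :
    ℕ → E → Option R → ℝ
  | 0 => initEmb hd
  | l + 1 => fun e j =>
      rawMin rvec a 𝓕 (embMin rvec a 𝓕 hd l) e j /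
        ∑ j' : Option R, |rawMin rvec a 𝓕 (embMin rvec a 𝓕 hd l) e j'|

/-- Unnormalized Hadamard-pooled message: the componentwise product of
`{prev e} ∪ {φ(prev f, 𝐫_p) : r_p(f,e) ∈ 𝓕}`. -/
def rawProd [Fintype R] [Fintype E] (rvec : Option R → Option R → ℝ)
    (a : Option R → Option R → Option R → ℝ) (𝓕 : Set (R × E × E))
    (prev : E → Option R → ℝ) (e : E) (j : Option R) : ℝ :=
  prev e j * ∏ pf : R × E,
    (if (pf.1, pf.2, e) ∈ 𝓕 then phi a (prev pf.2) (rvec (some pf.1)) j else 1)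

/-- The forward EpiGNN with normalized Hadamard-product pooling `ψ_⊙`. -/
def embProd [Fintype R] [Fintype E] (rvec : Option R → Option R → ℝ)
    (a : Option R → Option R → Option R → ℝ) (𝓕 : Set (R × E × E)) (hd : E) :
    ℕ → E → Option R → ℝ
  | 0 => initEmb hd
  | l + 1 => fun e j =>
      rawProd rvec a 𝓕 (embProd rvec a 𝓕 hd l) e j /
        ∑ j' : Option R, |rawProd rvec a 𝓕 (embProd rvec a 𝓕 hd l) e j'|

/-- The forward EpiGNN with `ε`-shifted Hadamard-product pooling `ψ_⊙^ε`:
`(x₁⊙…⊙x_k + z)/‖x₁⊙…⊙x_k + z‖₁` where `z = (ε,…,ε)`. -/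
def embProdEps [Fintype R] [Fintype E] (ε : ℝ) (rvec : Option R → Option R → ℝ)
    (a : Option R → Option R → Option R → ℝ) (𝓕 : Set (R × E × E)) (hd : E) :
    ℕ → E → Option R → ℝ
  | 0 => initEmb hd
  | l + 1 => fun e j =>
      (rawProd rvec a 𝓕 (embProdEps ε rvec a 𝓕 hd l) e j + ε) /
        ∑ j' : Option R, |rawProd rvec a 𝓕 (embProdEps ε rvec a 𝓕 hd l) e j' + ε|

/-- The composition `r_i ∘ r_j` extended to the identity relation (`none`):
`id ∘ r_j = {r_j}` and `r_i ∘ id = {r_i}`. -/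
def ecomp (comp : R → R → Set R) : Option R → Option R → Set (Option R)
  | none, j => {j}
  | some r, none => {some r}
  | some r, some s => some '' comp r s

/-- The canonical composition vectors: the `l`-th coordinate of `𝐚_{ij}` is
`1/|r_i∘r_j|` if `r_l ∈ r_i∘r_j` and `0` otherwise. -/
def canonA (comp : R → R → Set R) : Option R → Option R → Option R → ℝ :=
  fun i j l => if l ∈ ecomp comp i j then ((ecomp comp i j).ncard : ℝ)⁻¹ else 0

end

end EpiGNN

open EpiGNN in
/-- assuming `𝓚` (composition rules, disjointness constraints,
exhaustiveness rule) is consistent with `𝓕`, if `𝓕` contains facts `r_l(h,e)` and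
`r_p(f,e)` with `f ≠ h`, then there is a relation `r_q` with `r_l ∈ r_q ∘ r_p`. -/
theorem exists_comp_witness_of_consistent
    {R E : Type*} [Fintype R] [Fintype E]
    (comp : R → R → Set R) (𝓕 : Set (R × E × E))
    (hcons : ∃ ω : Set (R × E × E), IsModel comp 𝓕 ω)
    (rl rp : R) (hd e f : E) (hne : f ≠ hd)
    (h₁ : (rl, hd, e) ∈ 𝓕) (h₂ : (rp, f, e) ∈ 𝓕) :
    ∃ rq : R, rl ∈ comp rq rp := by
  obtain ⟨ω, hsub, hcomp, hdisj, hex⟩ := hcons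
  obtain ⟨rq, hq⟩ := hex hd f
  obtain ⟨t, ht, htω⟩ := hcomp rq rp hd f e hq (hsub h₂)
  have htl : t = rl := by
    by_contra hn
    exact hdisj t rl hd e hn ⟨htω, hsub h₁⟩
  exact ⟨rq, htl ▸ ht⟩
end
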